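/- arXiv:quant-ph/9807008 — 2 statements merged into one kernel-verified Lean document; each statement's English description precedes it below -/
import Mathlib

section
/- Knowledge decreases uncertainty: Let σ be a state on M_n(ℂ)⊗M_m(ℂ), and define the conditional entropy H(A|B)_σ = H(σ) − H(Tr_A σ), where Tr_A is the partial trace over the first factor. Let Φ be a quantum channel from M_m(ℂ) to M_{m'}(ℂ). Then H(A|B)_σ ≤ H(A|B')_{(id⊗Φ)(σ)}; in particular H(A|B)_σ ≤ H(Tr_B σ), the entropy of the first marginal. -/
open scoped ComplexOrder Kronecker
open Matrix

noncomputable def negMulLogb (x : ℝ) : ℝ := -(x * Real.logb 2 x)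

noncomputable def shannonEntropy {α : Type*} [Fintype α] (p : α → ℝ) : ℝ :=
  ∑ i, negMulLogb (p i)

noncomputable def mutualInfo {α β : Type*} [Fintype α] [Fintype β]
    (p : α → β → ℝ) : ℝ :=
  shannonEntropy (fun i => ∑ j, p i j) + shannonEntropy (fun j => ∑ i, p i j)
    - shannonEntropy (fun ij : α × β => p ij.1 ij.2)

noncomputable def binEnt (t : ℝ) : ℝ := negMulLogb t + negMulLogb (1 - t)

noncomputable def vnEntropy {α : Type*} [Fintype α] [DecidableEq α]
    (ρ : Matrix α α ℂ) : ℝ :=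
  if h : ρ.IsHermitian then ∑ i, negMulLogb (h.eigenvalues i) else 0

noncomputable def matLogb {α : Type*} [Fintype α] [DecidableEq α]
    (A : Matrix α α ℂ) : Matrix α α ℂ :=
  if h : A.IsHermitian then
    (h.eigenvectorUnitary : Matrix α α ℂ) *
      Matrix.diagonal (fun i => (Real.logb 2 (h.eigenvalues i) : ℂ)) *
      star (h.eigenvectorUnitary : Matrix α α ℂ)
  else 0

def MatState {α : Type*} [Fintype α] [DecidableEq α] (ρ : Matrix α α ℂ) : Prop :=
  ρ.PosSemidef ∧ ρ.trace = 1

def IsProjn {α : Type*} [Fintype α] [DecidableEq α] (p : Matrix α α ℂ) : Prop :=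
  p.IsHermitian ∧ p * p = p

def IsMinProjOf {α : Type*} [Fintype α] [DecidableEq α]
    (X : StarSubalgebra ℂ (Matrix α α ℂ)) (p : Matrix α α ℂ) : Prop :=
  p ∈ X ∧ IsProjn p ∧ p ≠ 0 ∧
    ∀ q ∈ X, IsProjn q → q * p = q → q = 0 ∨ q = p

def IsCanonicalTrace {α : Type*} [Fintype α] [DecidableEq α]
    (X : StarSubalgebra ℂ (Matrix α α ℂ)) (τ : Matrix α α ℂ →ₗ[ℂ] ℂ) : Prop :=
  (∀ x ∈ X, ∀ y ∈ X, τ (x * y) = τ (y * x)) ∧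
  (∀ x ∈ X, 0 ≤ τ (star x * x)) ∧
  (∀ p, IsMinProjOf X p → τ p = 1)

def IsRestriction {α : Type*} [Fintype α] [DecidableEq α]
    (X : StarSubalgebra ℂ (Matrix α α ℂ)) (τ : Matrix α α ℂ →ₗ[ℂ] ℂ)
    (ρ r : Matrix α α ℂ) : Prop :=
  r ∈ X ∧ r.PosSemidef ∧ ∀ x ∈ X, τ (r * x) = (ρ * x).trace

noncomputable def algEntropy {α : Type*} [Fintype α] [DecidableEq α]
    (τ : Matrix α α ℂ →ₗ[ℂ] ℂ) (r : Matrix α α ℂ) : ℝ :=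
  -(τ (r * matLogb r)).re

def IsAlgEntropy {α : Type*} [Fintype α] [DecidableEq α]
    (X : StarSubalgebra ℂ (Matrix α α ℂ)) (ρ : Matrix α α ℂ) (H : ℝ) : Prop :=
  ∃ τ r, IsCanonicalTrace X τ ∧ IsRestriction X τ ρ r ∧ H = algEntropy τ r

def CompatibleAlg {α : Type*} [Fintype α] [DecidableEq α]
    (X Y : StarSubalgebra ℂ (Matrix α α ℂ)) : Prop :=
  ∀ x ∈ X, ∀ y ∈ Y, x * y = y * x

/-- Partial trace over the first tensor factor. -/
noncomputable def ptraceA {n m : ℕ}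
    (σ : Matrix (Fin n × Fin m) (Fin n × Fin m) ℂ) : Matrix (Fin m) (Fin m) ℂ :=
  Matrix.of fun b1 b2 => ∑ a, σ (a, b1) (a, b2)

/-- Partial trace over the second tensor factor. -/
noncomputable def ptraceB {n m : ℕ}
    (σ : Matrix (Fin n × Fin m) (Fin n × Fin m) ℂ) : Matrix (Fin n) (Fin n) ℂ :=
  Matrix.of fun a1 a2 => ∑ b, σ (a1, b) (a2, b)

open Filter Topology in
theorem sum_mul_log_nonpos_of_resolvent_sum_nonneg {ι : Type*} [Fintype ι] (c x : ι → ℝ)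
    (hx : ∀ k, c k ≠ 0 → 0 < x k) (hc : ∑ k, c k = 0)
    (h : ∀ t : ℝ, 0 < t → 0 ≤ ∑ k, c k / (x k + t)) :
    ∑ k, c k * Real.log (x k) ≤ 0 := by
  set g : ℝ → ℝ := fun t => ∑ k, c k * Real.log (x k + t)
  have hderiv : ∀ t : ℝ, 0 ≤ t → HasDerivAt g (∑ k, c k / (x k + t)) t := by
    intro t ht
    refine HasDerivAt.fun_sum fun k _ => ?_
    by_cases hk : c k = 0
    · simpa [hk] using hasDerivAt_const t (0 : ℝ)
    · have hpos : x k + t ≠ 0 := (add_pos_of_pos_of_nonneg (hx k hk) ht).ne'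
      have := (((hasDerivAt_id t).const_add (x k)).log hpos).const_mul (c k)
      simpa [div_eq_mul_inv] using this
  have hmono : MonotoneOn g (Set.Ici 0) := by
    refine monotoneOn_of_deriv_nonneg (convex_Ici 0)
      (fun t ht => (hderiv t ht).continuousAt.continuousWithinAt) ?_ ?_
    · intro t ht
      rw [interior_Ici] at ht
      exact (hderiv t (le_of_lt ht)).differentiableAt.differentiableWithinAt
    · intro t ht
      rw [interior_Ici] at ht
      rw [(hderiv t (le_of_lt ht)).deriv]
      exact h t ht
  have hlim : Tendsto g atTop (𝓝 0) := by
    have h1 : Tendsto (fun t => ∑ k, c k * (Real.log (t + x k) - Real.log t)) atTop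
        (𝓝 (∑ k, c k * 0)) :=
      tendsto_finsetSum _ fun k _ => (Real.tendsto_log_comp_add_sub_log (x k)).const_mul (c k)
    have h2 : (fun t => ∑ k, c k * (Real.log (t + x k) - Real.log t)) = g := by
      funext t
      simp only [g, mul_sub, Finset.sum_sub_distrib, ← Finset.sum_mul, hc, zero_mul, sub_zero,
        add_comm t]
    simpa [h2] using h1
  have := ge_of_tendsto hlim (eventually_atTop.2 ⟨0, fun t ht =>
    hmono (Set.self_mem_Ici) (Set.mem_Ici.2 ht) ht⟩)
  simpa [g] using this

theorem sum_mul_log_le_of_resolvent_sum_le {ι ι' : Type*} [Fintype ι] [Fintype ι']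
    (c x : ι → ℝ) (d y : ι' → ℝ) (hx : ∀ k, c k ≠ 0 → 0 < x k) (hy : ∀ k, d k ≠ 0 → 0 < y k)
    (hcd : ∑ k, c k = ∑ k, d k)
    (h : ∀ t : ℝ, 0 < t → ∑ k, d k / (y k + t) ≤ ∑ k, c k / (x k + t)) :
    ∑ k, c k * Real.log (x k) ≤ ∑ k, d k * Real.log (y k) := by
  have := sum_mul_log_nonpos_of_resolvent_sum_nonneg (Sum.elim c (-d)) (Sum.elim x y)
    (by rintro (k | k) hk
        · exact hx k hk
        · exact hy k (by simpa using hk))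
    (by simp [hcd])
    (by intro t ht
        have := h t ht
        simp only [Fintype.sum_sum_type, Sum.elim_inl, Sum.elim_inr, Pi.neg_apply, neg_div,
          Finset.sum_neg_distrib]
        linarith)
  simp only [Fintype.sum_sum_type, Sum.elim_inl, Sum.elim_inr, Pi.neg_apply, neg_mul,
    Finset.sum_neg_distrib] at this
  linarith

/-- `V` is unitary and `τ = V diag(q) V*`. -/
def Diagonalizes {α : Type*} [Fintype α] [DecidableEq α] (V : Matrix α α ℂ) (q : α → ℝ)
    (τ : Matrix α α ℂ) : Prop :=
  V * Vᴴ = 1 ∧ Vᴴ * V = 1 ∧ τ = V * diagonal (fun i => (q i : ℂ)) * Vᴴ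

theorem Matrix.IsHermitian.diagonalizes {α : Type*} [Fintype α] [DecidableEq α]
    {τ : Matrix α α ℂ} (h : τ.IsHermitian) :
    Diagonalizes (h.eigenvectorUnitary : Matrix α α ℂ) h.eigenvalues τ :=
  ⟨Unitary.mul_star_self_of_mem h.eigenvectorUnitary.2,
    Unitary.star_mul_self_of_mem h.eigenvectorUnitary.2, h.spectral_theorem⟩

/-- The image of `ρ` under the map with Kraus operators `K`. -/
def krausMap {κ α β : Type*} [Fintype κ] [Fintype α] (K : κ → Matrix β α ℂ)
    (ρ : Matrix α α ℂ) : Matrix β β ℂ :=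
  ∑ k, K k * ρ * (K k)ᴴ

section Kraus

variable {κ α β : Type*} [Fintype κ] [Fintype α] [Fintype β] (K : κ → Matrix β α ℂ)

theorem krausMap_posSemidef {ρ : Matrix α α ℂ} (hρ : ρ.PosSemidef) :
    (krausMap K ρ).PosSemidef :=
  posSemidef_sum _ fun k _ => hρ.mul_mul_conjTranspose_same (K k)

theorem trace_krausMap_mul (ρ : Matrix α α ℂ) (Y : Matrix β β ℂ) :
    (krausMap K ρ * Y).trace = (ρ * krausMap (fun k => (K k)ᴴ) Y).trace := by
  simp only [krausMap, Finset.sum_mul, Finset.mul_sum, trace_sum, conjTranspose_conjTranspose]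
  refine Finset.sum_congr rfl fun k _ => ?_
  rw [Matrix.mul_assoc, Matrix.mul_assoc, trace_mul_comm]
  simp only [Matrix.mul_assoc]

omit [Fintype β] in
theorem krausMap_conjTranspose (Y : Matrix α α ℂ) :
    (krausMap K Y)ᴴ = krausMap K Yᴴ := by
  simp [krausMap, conjTranspose_sum, Matrix.mul_assoc]

/-- The Kadison–Schwarz inequality for a unital map in Kraus form, tested against a positive
semidefinite matrix. -/
theorem trace_mul_krausMap_mul_conjTranspose_le [DecidableEq α] (hK : ∑ k, (K k)ᴴ * K k = 1)
    {τ : Matrix α α ℂ} (hτ : τ.PosSemidef) (Y : Matrix β β ℂ) :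
    (τ * (krausMap (fun k => (K k)ᴴ) Y * (krausMap (fun k => (K k)ᴴ) Y)ᴴ)).trace.re ≤
      (krausMap K τ * (Y * Yᴴ)).trace.re := by
  set Z := krausMap (fun k => (K k)ᴴ) Y with hZ
  have hZ' : Z = ∑ k, (K k)ᴴ * Y * K k := by simp [hZ, krausMap]
  have hZh : Zᴴ = ∑ k, (K k)ᴴ * Yᴴ * K k := by
    simp [hZ', conjTranspose_sum, Matrix.mul_assoc]
  have hdefect : ∑ k, (Yᴴ * K k - K k * Zᴴ)ᴴ * (Yᴴ * K k - K k * Zᴴ) =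
      krausMap (fun k => (K k)ᴴ) (Y * Yᴴ) - Z * Zᴴ := by
    have h1 : ∀ k, (Yᴴ * K k - K k * Zᴴ)ᴴ * (Yᴴ * K k - K k * Zᴴ) =
        (K k)ᴴ * (Y * Yᴴ) * K k - ((K k)ᴴ * Y * K k) * Zᴴ - Z * ((K k)ᴴ * Yᴴ * K k)
          + Z * ((K k)ᴴ * K k) * Zᴴ := by
      intro k
      simp only [conjTranspose_sub, conjTranspose_mul, conjTranspose_conjTranspose]
      simp only [Matrix.sub_mul, Matrix.mul_sub, Matrix.mul_assoc]
      abel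
    simp only [h1, Finset.sum_add_distrib, Finset.sum_sub_distrib, ← Finset.sum_mul,
      ← Finset.mul_sum, hK, ← hZ', ← hZh]
    simp [krausMap]
  have hnn : 0 ≤ (τ * ∑ k, (Yᴴ * K k - K k * Zᴴ)ᴴ * (Yᴴ * K k - K k * Zᴴ)).trace := by
    rw [Finset.mul_sum, trace_sum]
    refine Finset.sum_nonneg fun k _ => ?_
    rw [← Matrix.mul_assoc, trace_mul_comm, ← Matrix.mul_assoc]
    exact (hτ.mul_mul_conjTranspose_same _).trace_nonneg
  rw [hdefect, Matrix.mul_sub, trace_sub, ← trace_krausMap_mul] at hnn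
  have := (Complex.le_def.1 hnn).1
  simp only [Complex.zero_re, Complex.sub_re] at this
  linarith

/-- The quadratic form whose supremum over `Y` is `⟨ρ, (L_τ + t R_ρ)⁻¹ ρ⟩`. -/
def resolventForm (ρ τ : Matrix α α ℂ) (t : ℝ) (Y : Matrix α α ℂ) : ℝ :=
  2 * (ρ * Y).trace.re - (τ * (Y * Yᴴ)).trace.re - t * (ρ * (Yᴴ * Y)).trace.re

theorem resolventForm_krausMap_le [DecidableEq α] (hK : ∑ k, (K k)ᴴ * K k = 1)
    {ρ τ : Matrix α α ℂ} (hρ : ρ.PosSemidef) (hτ : τ.PosSemidef) {t : ℝ} (ht : 0 ≤ t)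
    (Y : Matrix β β ℂ) :
    resolventForm (krausMap K ρ) (krausMap K τ) t Y ≤
      resolventForm ρ τ t (krausMap (fun k => (K k)ᴴ) Y) := by
  have h1 := trace_mul_krausMap_mul_conjTranspose_le K hK hτ Y
  have h2 := trace_mul_krausMap_mul_conjTranspose_le K hK hρ Yᴴ
  rw [← krausMap_conjTranspose, conjTranspose_conjTranspose, conjTranspose_conjTranspose] at h2
  have h3 := mul_le_mul_of_nonneg_left h2 ht
  unfold resolventForm
  rw [trace_krausMap_mul K ρ Y]
  linarith

end Kraus

section Spectral

variable {α : Type*} [Fintype α] [DecidableEq α] {U V ρ τ : Matrix α α ℂ} {p q : α → ℝ}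

theorem resolventForm_eq_sum (hρ : Diagonalizes U p ρ) (hτ : Diagonalizes V q τ) (t : ℝ)
    (Z : Matrix α α ℂ) :
    resolventForm ρ τ t (V * Z * Uᴴ) = ∑ i, ∑ j,
      (2 * (p i * ((Uᴴ * V) i j * Z j i).re) - (q j + t * p i) * Complex.normSq (Z j i)) := by
  obtain ⟨-, hU, rfl⟩ := hρ
  obtain ⟨-, hV, rfl⟩ := hτ
  set P := diagonal (fun i => (p i : ℂ))
  set Q := diagonal (fun i => (q i : ℂ))
  have h1 : (U * P * Uᴴ * (V * Z * Uᴴ)).trace = (P * ((Uᴴ * V) * Z)).trace := by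
    rw [← Matrix.mul_assoc _ _ Uᴴ, trace_mul_comm]
    simp only [← Matrix.mul_assoc, hU, Matrix.one_mul]
  have h2 : (V * Q * Vᴴ * (V * Z * Uᴴ * (V * Z * Uᴴ)ᴴ)).trace = (Q * (Z * Zᴴ)).trace := by
    have : V * Q * Vᴴ * (V * Z * Uᴴ * (V * Z * Uᴴ)ᴴ) =
        V * (Q * (Vᴴ * V) * Z * (Uᴴ * U) * Zᴴ) * Vᴴ := by
      simp [Matrix.mul_assoc]
    rw [this, trace_mul_comm, ← Matrix.mul_assoc, hV, hU]
    simp [Matrix.mul_assoc]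
  have h3 : (U * P * Uᴴ * ((V * Z * Uᴴ)ᴴ * (V * Z * Uᴴ))).trace = (P * (Zᴴ * Z)).trace := by
    have : U * P * Uᴴ * ((V * Z * Uᴴ)ᴴ * (V * Z * Uᴴ)) =
        U * (P * (Uᴴ * U) * Zᴴ * (Vᴴ * V) * Z) * Uᴴ := by
      simp [Matrix.mul_assoc]
    rw [this, trace_mul_comm, ← Matrix.mul_assoc, hV, hU]
    simp [Matrix.mul_assoc]
  have e1 : (P * ((Uᴴ * V) * Z)).trace.re = ∑ i, ∑ j, p i * ((Uᴴ * V) i j * Z j i).re := by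
    simp only [P, trace, diag_apply, diagonal_mul, Complex.re_sum, Complex.re_ofReal_mul,
      mul_apply (M := Uᴴ * V), Finset.mul_sum]
  have e2 : (Q * (Z * Zᴴ)).trace.re = ∑ i, ∑ j, q j * Complex.normSq (Z j i) := by
    rw [Finset.sum_comm]
    simp only [Q, trace, diag_apply, diagonal_mul, Complex.re_sum, Complex.re_ofReal_mul,
      mul_apply (M := Z), Finset.mul_sum, conjTranspose_apply, RCLike.star_def, Complex.mul_conj,
      Complex.ofReal_re]
  have e3 : (P * (Zᴴ * Z)).trace.re = ∑ i, ∑ j, p i * Complex.normSq (Z j i) := by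
    simp only [P, trace, diag_apply, diagonal_mul, Complex.re_sum, Complex.re_ofReal_mul,
      mul_apply (M := Zᴴ), Finset.mul_sum, conjTranspose_apply, RCLike.star_def,
      ← Complex.normSq_eq_conj_mul_self, Complex.ofReal_re]
  rw [resolventForm, h1, h2, h3, e1, e2, e3]
  simp only [Finset.mul_sum, ← Finset.sum_sub_distrib]
  refine Finset.sum_congr rfl fun i _ => Finset.sum_congr rfl fun j _ => ?_
  ring

theorem two_mul_re_sub_le {a b : ℝ} (hb : 0 ≤ b) (hab : b = 0 → a = 0) (w z : ℂ) :
    2 * (a * (w * z).re) - b * Complex.normSq z ≤ Complex.normSq w * a ^ 2 / b := by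
  rcases hb.eq_or_lt with rfl | hb
  · simp [hab rfl]
  · rw [le_div_iff₀ hb]
    simp only [Complex.mul_re, Complex.normSq_apply]
    nlinarith [sq_nonneg (a * w.re - b * z.re), sq_nonneg (a * w.im + b * z.im)]

theorem resolventForm_le (hρ : Diagonalizes U p ρ) (hτ : Diagonalizes V q τ)
    (hp : ∀ i, 0 ≤ p i) (hq : ∀ j, 0 ≤ q j) {t : ℝ} (ht : 0 < t) (Y : Matrix α α ℂ) :
    resolventForm ρ τ t Y ≤
      ∑ i, ∑ j, Complex.normSq ((Uᴴ * V) i j) * p i ^ 2 / (q j + t * p i) := by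
  have hY : Y = V * (Vᴴ * Y * U) * Uᴴ := by
    have : V * (Vᴴ * Y * U) * Uᴴ = (V * Vᴴ) * Y * (U * Uᴴ) := by simp only [Matrix.mul_assoc]
    rw [this, hρ.1, hτ.1, Matrix.one_mul, Matrix.mul_one]
  rw [hY, resolventForm_eq_sum hρ hτ]
  refine Finset.sum_le_sum fun i _ => Finset.sum_le_sum fun j _ => ?_
  refine two_mul_re_sub_le (add_nonneg (hq j) (mul_nonneg ht.le (hp i))) (fun h => ?_) _ _
  nlinarith [hq j, hp i, mul_nonneg ht.le (hp i)]

theorem exists_resolventForm_eq (hρ : Diagonalizes U p ρ) (hτ : Diagonalizes V q τ) (t : ℝ) :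
    ∃ Y, resolventForm ρ τ t Y =
      ∑ i, ∑ j, Complex.normSq ((Uᴴ * V) i j) * p i ^ 2 / (q j + t * p i) := by
  refine ⟨V * (Matrix.of fun j i =>
    star ((Uᴴ * V) i j) * ((p i / (q j + t * p i) : ℝ) : ℂ)) * Uᴴ, ?_⟩
  rw [resolventForm_eq_sum hρ hτ]
  refine Finset.sum_congr rfl fun i _ => Finset.sum_congr rfl fun j _ => ?_
  rw [of_apply, ← mul_assoc ((Uᴴ * V) i j), RCLike.star_def, Complex.mul_conj,
    ← Complex.ofReal_mul, Complex.ofReal_re, map_mul, Complex.normSq_conj, Complex.normSq_ofReal]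
  by_cases h : q j + t * p i = 0
  · simp [h]
  · field_simp
    ring

theorem sum_normSq_row_eq_one (hU : Uᴴ * U = 1) (hV : V * Vᴴ = 1) (i : α) :
    ∑ j, Complex.normSq ((Uᴴ * V) i j) = 1 := by
  have h : (Uᴴ * V) * (Uᴴ * V)ᴴ = 1 := by
    rw [conjTranspose_mul, conjTranspose_conjTranspose, Matrix.mul_assoc, ← Matrix.mul_assoc V,
      hV, Matrix.one_mul, hU]
  have := congrArg Complex.re (congrFun (congrFun h i) i)
  rw [mul_apply, Complex.re_sum, one_apply_eq, Complex.one_re] at this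
  rw [← this]
  refine Finset.sum_congr rfl fun j _ => ?_
  rw [conjTranspose_apply, RCLike.star_def, Complex.mul_conj, Complex.ofReal_re]

theorem sum_normSq_mul_eq_diag (hρ : Diagonalizes U p ρ) (j : α) :
    ∑ i, Complex.normSq ((Uᴴ * V) i j) * p i = ((Vᴴ * ρ * V) j j).re := by
  have h : Vᴴ * ρ * V = (Uᴴ * V)ᴴ * (diagonal (fun i => (p i : ℂ)) * (Uᴴ * V)) := by
    rw [hρ.2.2]
    simp [Matrix.mul_assoc]
  rw [h, mul_apply, Complex.re_sum]
  refine Finset.sum_congr rfl fun i _ => ?_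
  rw [diagonal_mul, conjTranspose_apply, mul_left_comm, RCLike.star_def,
    ← Complex.normSq_eq_conj_mul_self, ← Complex.ofReal_mul, Complex.ofReal_re, mul_comm]

theorem normSq_mul_eq_zero_of_diag_eq_zero (hρ : Diagonalizes U p ρ) (hp : ∀ i, 0 ≤ p i) {j : α}
    (hj : ((Vᴴ * ρ * V) j j).re = 0) (i : α) :
    Complex.normSq ((Uᴴ * V) i j) * p i = 0 := by
  rw [← sum_normSq_mul_eq_diag hρ, Finset.sum_eq_zero_iff_of_nonneg
    fun i _ => mul_nonneg (Complex.normSq_nonneg _) (hp i)] at hj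
  exact hj i (Finset.mem_univ i)

theorem div_pos_of_normSq_mul_ne_zero (hρ : Diagonalizes U p ρ) (hp : ∀ i, 0 ≤ p i)
    (hq : ∀ j, 0 ≤ q j) (hsupp : ∀ j, q j = 0 → ((Vᴴ * ρ * V) j j).re = 0) {i j : α}
    (h : Complex.normSq ((Uᴴ * V) i j) * p i ≠ 0) : 0 < q j / p i :=
  div_pos ((hq j).lt_of_ne' fun h0 => h (normSq_mul_eq_zero_of_diag_eq_zero hρ hp (hsupp j h0) i))
    ((hp i).lt_of_ne' (right_ne_zero_of_mul h))

theorem sum_sum_normSq_mul_eq_trace (hρ : Diagonalizes U p ρ) (hV : V * Vᴴ = 1) :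
    ∑ i, ∑ j, Complex.normSq ((Uᴴ * V) i j) * p i = ρ.trace.re := by
  simp only [← Finset.sum_mul, sum_normSq_row_eq_one hρ.2.1 hV, one_mul]
  rw [hρ.2.2, trace_mul_comm, ← Matrix.mul_assoc, hρ.2.1, Matrix.one_mul, trace_diagonal,
    Complex.re_sum]
  simp only [Complex.ofReal_re]

theorem mul_div_div_add_eq (w p q t : ℝ) :
    w * p / (q / p + t) = w * p ^ 2 / (q + t * p) := by
  by_cases hp : p = 0
  · simp [hp]
  · rw [div_add' _ _ _ hp, div_div_eq_mul_div]
    ring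

theorem sum_sum_normSq_mul_log_div (hρ : Diagonalizes U p ρ) (hτ : Diagonalizes V q τ)
    (hp : ∀ i, 0 ≤ p i) (hsupp : ∀ j, q j = 0 → ((Vᴴ * ρ * V) j j).re = 0) :
    ∑ i, ∑ j, Complex.normSq ((Uᴴ * V) i j) * p i * Real.log (q j / p i) =
      ∑ j, ((Vᴴ * ρ * V) j j).re * Real.log (q j) - ∑ i, p i * Real.log (p i) := by
  have hterm : ∀ i j, Complex.normSq ((Uᴴ * V) i j) * p i * Real.log (q j / p i) =
      Complex.normSq ((Uᴴ * V) i j) * p i * Real.log (q j) -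
        Complex.normSq ((Uᴴ * V) i j) * (p i * Real.log (p i)) := by
    intro i j
    by_cases hq : q j = 0
    · rw [← mul_assoc, normSq_mul_eq_zero_of_diag_eq_zero hρ hp (hsupp j hq)]
      simp
    · by_cases hpi : p i = 0
      · simp [hpi]
      · rw [Real.log_div hq hpi]
        ring
  simp only [hterm, Finset.sum_sub_distrib, ← Finset.sum_mul,
    sum_normSq_row_eq_one hρ.2.1 hτ.1, one_mul]
  rw [Finset.sum_comm]
  simp only [← Finset.sum_mul, sum_normSq_mul_eq_diag hρ]

theorem vnEntropy_eq (h : ρ.IsHermitian) :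
    vnEntropy ρ = -(∑ i, h.eigenvalues i * Real.log (h.eigenvalues i)) / Real.log 2 := by
  simp only [vnEntropy, h, dif_pos, negMulLogb, Real.logb, Finset.sum_neg_distrib, neg_div,
    Finset.sum_div, mul_div_assoc]

end Spectral

/-- The data processing inequality: `Tr ρ (log τ - log ρ)` increases under trace preserving
completely positive maps. -/
theorem vnEntropy_add_sum_diag_mul_logb_le {κ α β : Type*} [Fintype κ] [Fintype α]
    [DecidableEq α] [Fintype β] [DecidableEq β] (K : κ → Matrix β α ℂ)
    (hK : ∑ k, (K k)ᴴ * K k = 1) {ρ τ V : Matrix α α ℂ} {V' : Matrix β β ℂ}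
    {q : α → ℝ} {q' : β → ℝ} (hρ : ρ.PosSemidef) (hτ : τ.PosSemidef)
    (hV : Diagonalizes V q τ) (hV' : Diagonalizes V' q' (krausMap K τ))
    (hq : ∀ j, 0 ≤ q j) (hq' : ∀ j, 0 ≤ q' j)
    (hsupp : ∀ j, q j = 0 → ((Vᴴ * ρ * V) j j).re = 0)
    (hsupp' : ∀ j, q' j = 0 → ((V'ᴴ * krausMap K ρ * V') j j).re = 0) :
    vnEntropy ρ + ∑ j, ((Vᴴ * ρ * V) j j).re * Real.logb 2 (q j) ≤
      vnEntropy (krausMap K ρ) +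
        ∑ j, ((V'ᴴ * krausMap K ρ * V') j j).re * Real.logb 2 (q' j) := by
  have hρ' := krausMap_posSemidef K hρ
  have hU := hρ.isHermitian.diagonalizes
  have hU' := hρ'.isHermitian.diagonalizes
  have hp := hρ.eigenvalues_nonneg
  have hp' := hρ'.eigenvalues_nonneg
  rw [vnEntropy_eq hρ.isHermitian, vnEntropy_eq hρ'.isHermitian]
  set p := hρ.isHermitian.eigenvalues
  set p' := hρ'.isHermitian.eigenvalues
  set U : Matrix α α ℂ := (hρ.isHermitian.eigenvectorUnitary : Matrix α α ℂ)
  set U' : Matrix β β ℂ := (hρ'.isHermitian.eigenvectorUnitary : Matrix β β ℂ)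
  have key := sum_mul_log_le_of_resolvent_sum_le
    (fun k : α × α => Complex.normSq ((Uᴴ * V) k.1 k.2) * p k.1) (fun k => q k.2 / p k.1)
    (fun k : β × β => Complex.normSq ((U'ᴴ * V') k.1 k.2) * p' k.1) (fun k => q' k.2 / p' k.1)
    (fun k => div_pos_of_normSq_mul_ne_zero hU hp hq hsupp)
    (fun k => div_pos_of_normSq_mul_ne_zero hU' hp' hq' hsupp')
    (by
      have htr : (krausMap K ρ).trace = ρ.trace := by
        simpa [krausMap, hK] using trace_krausMap_mul K ρ 1
      simp only [Fintype.sum_prod_type]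
      rw [sum_sum_normSq_mul_eq_trace hU hV.1, sum_sum_normSq_mul_eq_trace hU' hV'.1, htr])
    (by
      intro t ht
      simp only [Fintype.sum_prod_type, mul_div_div_add_eq]
      obtain ⟨Y, hY⟩ := exists_resolventForm_eq hU' hV' t
      rw [← hY]
      exact (resolventForm_krausMap_le K hK hρ hτ ht.le Y).trans
        (resolventForm_le hU hV hp hq ht _))
  simp only [Fintype.sum_prod_type] at key
  rw [sum_sum_normSq_mul_log_div hU hV hp hsupp,
    sum_sum_normSq_mul_log_div hU' hV' hp' hsupp'] at key
  have := div_le_div_of_nonneg_right key (Real.log_pos one_lt_two).le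
  simp only [Real.logb, sub_div, Finset.sum_div, mul_div_assoc, neg_div] at this ⊢
  linarith

section PartialTrace

variable {n m m' : ℕ}

theorem one_kronecker_mul_apply {γ : Type*} (B : Matrix (Fin m') (Fin m) ℂ)
    (X : Matrix (Fin n × Fin m) γ ℂ) (a : Fin n) (b : Fin m') (y : γ) :
    (((1 : Matrix (Fin n) (Fin n) ℂ) ⊗ₖ B) * X) (a, b) y = ∑ b', B b b' * X (a, b') y := by
  simp [mul_apply, Fintype.sum_prod_type, one_apply]

theorem mul_one_kronecker_apply {γ : Type*} (C : Matrix (Fin m) (Fin m') ℂ)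
    (X : Matrix γ (Fin n × Fin m) ℂ) (a : Fin n) (b : Fin m') (y : γ) :
    (X * ((1 : Matrix (Fin n) (Fin n) ℂ) ⊗ₖ C)) y (a, b) = ∑ b', X y (a, b') * C b' b := by
  simp [mul_apply, Fintype.sum_prod_type, one_apply]

theorem ptraceA_one_kronecker_mul_mul (B : Matrix (Fin m') (Fin m) ℂ)
    (C : Matrix (Fin m) (Fin m') ℂ) (σ : Matrix (Fin n × Fin m) (Fin n × Fin m) ℂ) :
    ptraceA (((1 : Matrix (Fin n) (Fin n) ℂ) ⊗ₖ B) * σ * ((1 : Matrix (Fin n) (Fin n) ℂ) ⊗ₖ C)) =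
      B * ptraceA σ * C := by
  ext i j
  simp only [ptraceA, of_apply, mul_one_kronecker_apply, one_kronecker_mul_apply]
  simp only [mul_apply, of_apply, Finset.mul_sum]
  rw [Finset.sum_comm]
  refine Finset.sum_congr rfl fun k _ => ?_
  rw [← Finset.sum_mul, Finset.sum_comm]

theorem ptraceA_posSemidef {σ : Matrix (Fin n × Fin m) (Fin n × Fin m) ℂ}
    (hσ : σ.PosSemidef) : (ptraceA σ).PosSemidef := by
  have h : ptraceA σ = ∑ a, σ.submatrix (fun b => (a, b)) (fun b => (a, b)) := by
    ext i j
    simp [ptraceA, Matrix.sum_apply]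
  rw [h]
  exact posSemidef_sum _ fun a _ => hσ.submatrix _

theorem Diagonalizes.one_kronecker {V ω : Matrix (Fin m) (Fin m) ℂ} {q : Fin m → ℝ}
    (h : Diagonalizes V q ω) :
    Diagonalizes ((1 : Matrix (Fin n) (Fin n) ℂ) ⊗ₖ V) (fun x => q x.2)
      ((1 : Matrix (Fin n) (Fin n) ℂ) ⊗ₖ ω) := by
  have hd : diagonal (fun x : Fin n × Fin m => (q x.2 : ℂ)) =
      (1 : Matrix (Fin n) (Fin n) ℂ) ⊗ₖ diagonal (fun j => (q j : ℂ)) := by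
    rw [← diagonal_one, diagonal_kronecker_diagonal]
    simp
  refine ⟨?_, ?_, ?_⟩
  · rw [conjTranspose_kronecker, ← mul_kronecker_mul, h.1]
    simp
  · rw [conjTranspose_kronecker, ← mul_kronecker_mul, h.2.1]
    simp
  · rw [conjTranspose_kronecker, hd, ← mul_kronecker_mul, ← mul_kronecker_mul, ← h.2.2]
    simp

variable {σ : Matrix (Fin n × Fin m) (Fin n × Fin m) ℂ} {V : Matrix (Fin m) (Fin m) ℂ}
  {q : Fin m → ℝ}

theorem sum_diag_one_kronecker (h : Diagonalizes V q (ptraceA σ)) (j : Fin m) :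
    ∑ a, ((((1 : Matrix (Fin n) (Fin n) ℂ) ⊗ₖ V)ᴴ * σ *
      ((1 : Matrix (Fin n) (Fin n) ℂ) ⊗ₖ V)) (a, j) (a, j)).re = q j := by
  have h1 := ptraceA_one_kronecker_mul_mul Vᴴ V σ
  have h2 : Vᴴ * ptraceA σ * V = diagonal (fun i => (q i : ℂ)) := by
    rw [h.2.2]
    have : Vᴴ * (V * diagonal (fun i => (q i : ℂ)) * Vᴴ) * V =
        (Vᴴ * V) * diagonal (fun i => (q i : ℂ)) * (Vᴴ * V) := by simp only [Matrix.mul_assoc]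
    rw [this, h.2.1, Matrix.one_mul, Matrix.mul_one]
  have h3 := congrArg Complex.re (congrFun (congrFun (h1.trans h2) j) j)
  rw [conjTranspose_kronecker, conjTranspose_one]
  simpa [ptraceA] using h3

theorem diag_one_kronecker_eq_zero (hσ : σ.PosSemidef) (h : Diagonalizes V q (ptraceA σ))
    (x : Fin n × Fin m) (hx : q x.2 = 0) :
    ((((1 : Matrix (Fin n) (Fin n) ℂ) ⊗ₖ V)ᴴ * σ *
      ((1 : Matrix (Fin n) (Fin n) ℂ) ⊗ₖ V)) x x).re = 0 := by
  have hnn := hσ.conjTranspose_mul_mul_same ((1 : Matrix (Fin n) (Fin n) ℂ) ⊗ₖ V)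
  have h0 := sum_diag_one_kronecker h x.2
  rw [hx, Finset.sum_eq_zero_iff_of_nonneg
    fun a _ => (Complex.le_def.1 hnn.diag_nonneg).1] at h0
  exact h0 x.1 (Finset.mem_univ _)

theorem sum_diag_one_kronecker_mul_logb (hσ : σ.PosSemidef) :
    ∑ x : Fin n × Fin m, ((((1 : Matrix (Fin n) (Fin n) ℂ) ⊗ₖ
        ((ptraceA_posSemidef hσ).isHermitian.eigenvectorUnitary : Matrix (Fin m) (Fin m) ℂ))ᴴ * σ *
      ((1 : Matrix (Fin n) (Fin n) ℂ) ⊗ₖ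
        ((ptraceA_posSemidef hσ).isHermitian.eigenvectorUnitary : Matrix (Fin m) (Fin m) ℂ)))
        x x).re * Real.logb 2 ((ptraceA_posSemidef hσ).isHermitian.eigenvalues x.2) =
      -vnEntropy (ptraceA σ) := by
  rw [Fintype.sum_prod_type, Finset.sum_comm]
  simp only [← Finset.sum_mul,
    sum_diag_one_kronecker (ptraceA_posSemidef hσ).isHermitian.diagonalizes]
  simp [vnEntropy, (ptraceA_posSemidef hσ).isHermitian, negMulLogb]

theorem ptraceA_krausMap_one_kronecker {κ : Type*} [Fintype κ]
    (A : κ → Matrix (Fin m') (Fin m) ℂ) (σ : Matrix (Fin n × Fin m) (Fin n × Fin m) ℂ) :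
    ptraceA (krausMap (fun k => (1 : Matrix (Fin n) (Fin n) ℂ) ⊗ₖ A k) σ) =
      krausMap A (ptraceA σ) := by
  have h : ∀ X : κ → Matrix (Fin n × Fin m') (Fin n × Fin m') ℂ,
      ptraceA (∑ k, X k) = ∑ k, ptraceA (X k) := by
    intro X
    ext i j
    simp only [ptraceA, of_apply, Matrix.sum_apply]
    exact Finset.sum_comm
  simp only [krausMap, h, conjTranspose_kronecker, conjTranspose_one,
    ptraceA_one_kronecker_mul_mul]

theorem krausMap_one_kronecker_one_kronecker {κ : Type*} [Fintype κ]
    (A : κ → Matrix (Fin m') (Fin m) ℂ) (ω : Matrix (Fin m) (Fin m) ℂ) :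
    krausMap (fun k => (1 : Matrix (Fin n) (Fin n) ℂ) ⊗ₖ A k)
      ((1 : Matrix (Fin n) (Fin n) ℂ) ⊗ₖ ω) =
      (1 : Matrix (Fin n) (Fin n) ℂ) ⊗ₖ krausMap A ω := by
  simp only [krausMap, conjTranspose_kronecker, conjTranspose_one, ← mul_kronecker_mul,
    Matrix.one_mul]
  ext ⟨a, b⟩ ⟨a', b'⟩
  simp [Matrix.sum_apply, Finset.mul_sum]

/-- The Kraus operator of the partial trace over the second factor labelled by `b`. -/
def ptraceBKraus (b : Fin m) : Matrix (Fin n) (Fin n × Fin m) ℂ :=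
  (1 : Matrix (Fin n × Fin m) (Fin n × Fin m) ℂ).submatrix (fun a => (a, b)) id

theorem krausMap_ptraceBKraus (σ : Matrix (Fin n × Fin m) (Fin n × Fin m) ℂ) :
    krausMap ptraceBKraus σ = ptraceB σ := by
  ext i j
  simp [krausMap, ptraceBKraus, ptraceB, Matrix.sum_apply, mul_apply, one_apply]

theorem sum_ptraceBKraus :
    ∑ b : Fin m, (ptraceBKraus (n := n) b)ᴴ * ptraceBKraus (n := n) b = 1 := by
  ext ⟨i, k⟩ ⟨j, l⟩
  simp only [Matrix.sum_apply, mul_apply, conjTranspose_apply, ptraceBKraus, submatrix_apply,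
    one_apply]
  simp [Prod.ext_iff, ite_and, apply_ite (starRingEnd ℂ), eq_comm (a := j), eq_comm (a := l)]

theorem ptraceB_one_kronecker (ω : Matrix (Fin m) (Fin m) ℂ) :
    ptraceB ((1 : Matrix (Fin n) (Fin n) ℂ) ⊗ₖ ω) = ω.trace • (1 : Matrix (Fin n) (Fin n) ℂ) := by
  ext i j
  by_cases h : i = j <;> simp [ptraceB, trace, one_apply, h]

theorem trace_ptraceA (σ : Matrix (Fin n × Fin m) (Fin n × Fin m) ℂ) :
    (ptraceA σ).trace = σ.trace := by
  simp only [ptraceA, trace, diag_apply, of_apply, Fintype.sum_prod_type]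
  exact Finset.sum_comm

end PartialTrace

/-- knowledge decreases uncertainty: for a state `σ` on
`M_n(ℂ)⊗M_m(ℂ)` and a quantum channel `Φ` on the second factor (in Kraus form),
`H(A|B)_σ ≤ H(A|B')_{(id⊗Φ)σ}`, and in particular `H(A|B)_σ ≤ H(Tr_B σ)`. -/
theorem knowledge_decreases_uncertainty {n m m' : ℕ} {κ : Type} [Fintype κ]
    (σ : Matrix (Fin n × Fin m) (Fin n × Fin m) ℂ) (hσ : MatState σ)
    (A : κ → Matrix (Fin m') (Fin m) ℂ)
    (hA : ∑ k, (A k)ᴴ * A k = 1) :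
    vnEntropy σ - vnEntropy (ptraceA σ) ≤
      vnEntropy (∑ k, ((1 : Matrix (Fin n) (Fin n) ℂ) ⊗ₖ A k) * σ *
          ((1 : Matrix (Fin n) (Fin n) ℂ) ⊗ₖ A k)ᴴ) -
        vnEntropy (ptraceA (∑ k, ((1 : Matrix (Fin n) (Fin n) ℂ) ⊗ₖ A k) * σ *
          ((1 : Matrix (Fin n) (Fin n) ℂ) ⊗ₖ A k)ᴴ)) ∧
    vnEntropy σ - vnEntropy (ptraceA σ) ≤ vnEntropy (ptraceB σ) := by
  obtain ⟨hσ, htr⟩ := hσ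
  have hω := ptraceA_posSemidef hσ
  have hV := hω.isHermitian.diagonalizes
  have hτ : ((1 : Matrix (Fin n) (Fin n) ℂ) ⊗ₖ ptraceA σ).PosSemidef := PosSemidef.one.kronecker hω
  constructor
  · set K := fun k => (1 : Matrix (Fin n) (Fin n) ℂ) ⊗ₖ A k
    change _ ≤ vnEntropy (krausMap K σ) - vnEntropy (ptraceA (krausMap K σ))
    have hσ' := krausMap_posSemidef K hσ
    have hω' := ptraceA_posSemidef hσ'
    have hV' := hω'.isHermitian.diagonalizes
    have hK : ∑ k, (K k)ᴴ * K k = 1 := by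
      have h := krausMap_one_kronecker_one_kronecker (n := n) (fun k => (A k)ᴴ) 1
      simpa [krausMap, K, conjTranspose_kronecker, hA] using h
    have hτ' : krausMap K ((1 : Matrix (Fin n) (Fin n) ℂ) ⊗ₖ ptraceA σ) =
        (1 : Matrix (Fin n) (Fin n) ℂ) ⊗ₖ ptraceA (krausMap K σ) := by
      rw [krausMap_one_kronecker_one_kronecker, ptraceA_krausMap_one_kronecker]
    have key := vnEntropy_add_sum_diag_mul_logb_le K hK hσ hτ hV.one_kronecker
      (hτ' ▸ hV'.one_kronecker) (fun x => hω.eigenvalues_nonneg x.2)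
      (fun x => hω'.eigenvalues_nonneg x.2) (diag_one_kronecker_eq_zero hσ hV)
      (diag_one_kronecker_eq_zero hσ' hV')
    rw [sum_diag_one_kronecker_mul_logb hσ, sum_diag_one_kronecker_mul_logb hσ'] at key
    simpa only [sub_eq_add_neg] using key
  · have hτ' : krausMap ptraceBKraus ((1 : Matrix (Fin n) (Fin n) ℂ) ⊗ₖ ptraceA σ) = 1 := by
      rw [krausMap_ptraceBKraus, ptraceB_one_kronecker, trace_ptraceA, htr, one_smul]
    have hV' : Diagonalizes (1 : Matrix (Fin n) (Fin n) ℂ) (fun _ => 1)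
        (krausMap ptraceBKraus ((1 : Matrix (Fin n) (Fin n) ℂ) ⊗ₖ ptraceA σ)) := by
      rw [hτ']
      simp [Diagonalizes]
    have key := vnEntropy_add_sum_diag_mul_logb_le ptraceBKraus sum_ptraceBKraus hσ hτ
      hV.one_kronecker hV' (fun x => hω.eigenvalues_nonneg x.2) (fun _ => zero_le_one)
      (diag_one_kronecker_eq_zero hσ hV) (fun _ h => absurd h one_ne_zero)
    rw [sum_diag_one_kronecker_mul_logb hσ, krausMap_ptraceBKraus] at key
    simpa [sub_eq_add_neg] using key
end

section
/- Let 𝔄 = ⊕_i M_{n_i}(ℂ) and 𝔅 = ⊕_j M_{m_j}(ℂ) be finite direct sums of matrix algebras with canonical traces, μ: 𝔄 → 𝔅 a surjective unital *-algebra homomorphism, and μ_*: 𝔅 → 𝔄 its adjoint with respect to the trace pairings, i.e. τ_𝔄(μ_*(B)·A) = τ_𝔅(B·μ(A)) for all A ∈ 𝔄, B ∈ 𝔅. Then: (i) for every minimal projection p of 𝔄, either μ(p) = 0 or μ_*(μ(p)) = p; (ii) μ(μ_*(q)) = q for every minimal projection q of 𝔅; (iii) if ρ is a state on 𝔅 and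 μ_*(ρ) = Σ_i α_i p_i is a spectral decomposition into mutually orthogonal minimal projections p_i of 𝔄 with coefficients α_i > 0, then ρ = Σ_i α_i μ(p_i), and the μ(p_i) are mutually orthogonal minimal projections of 𝔅; in particular μ_* preserves the nonzero eigenvalues (with multiplicity) of density operators. -/
open scoped ComplexOrder Kronecker
open Matrix

/-- Canonical trace on a finite direct sum of matrix algebras: the sum of the
matrix traces of the components. -/
noncomputable def piTrace {ι : Type} [Fintype ι] {d : ι → ℕ}
    (A : ∀ i, Matrix (Fin (d i)) (Fin (d i)) ℂ) : ℂ :=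
  ∑ i, (A i).trace

/-- A minimal projection of a finite direct sum of matrix algebras: a nonzero
self-adjoint idempotent dominating no projection other than `0` and itself. -/
def IsMinProjPi {ι : Type} [Fintype ι] {d : ι → ℕ}
    (p : ∀ i, Matrix (Fin (d i)) (Fin (d i)) ℂ) : Prop :=
  p ≠ 0 ∧ star p = p ∧ p * p = p ∧
    ∀ q : ∀ i, Matrix (Fin (d i)) (Fin (d i)) ℂ,
      star q = q → q * q = q → q * p = q → q = 0 ∨ q = p

section PiTrace

variable {ι κ : Type} {d : ι → ℕ} {e : κ → ℕ}

open Classical in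
/-- Each simple summand is either annihilated by a homomorphism or embedded by it. -/
lemma map_single_one_eq_zero
    (μ : (∀ i, Matrix (Fin (d i)) (Fin (d i)) ℂ) →⋆ₐ[ℂ]
         (∀ j, Matrix (Fin (e j)) (Fin (e j)) ℂ))
    {i : ι} {M : Matrix (Fin (d i)) (Fin (d i)) ℂ} (hM : M ≠ 0) (h : μ (Pi.single i M) = 0) :
    μ (Pi.single i 1) = 0 := by
  have hab : ∃ a b, M a b ≠ 0 := by
    by_contra! h
    exact hM (Matrix.ext h)
  obtain ⟨a, b, hab⟩ := hab
  have h1 : ∀ c, μ (Pi.single i (Matrix.single c c 1)) = 0 := fun c => by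
    have : Matrix.single c c (1 : ℂ) = Matrix.single c a (M a b)⁻¹ * M * Matrix.single b c 1 := by
      rw [single_mul_mul_single, inv_mul_cancel₀ hab, mul_one]
    rw [this, Pi.single_mul, Pi.single_mul, map_mul, map_mul, h, mul_zero, zero_mul]
  have h2 : (1 : Matrix (Fin (d i)) (Fin (d i)) ℂ) = ∑ c, Matrix.single c c 1 := by
    rw [sum_single_eq_diagonal]; rfl
  rw [h2, ← AddMonoidHom.single_apply, map_sum, map_sum]
  exact Finset.sum_eq_zero fun c _ => h1 c

variable [Fintype ι]

lemma piTrace_add (A B : ∀ i, Matrix (Fin (d i)) (Fin (d i)) ℂ) :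
    piTrace (A + B) = piTrace A + piTrace B := by
  simp [piTrace, Finset.sum_add_distrib]

lemma piTrace_smul (c : ℂ) (A : ∀ i, Matrix (Fin (d i)) (Fin (d i)) ℂ) :
    piTrace (c • A) = c * piTrace A := by
  simp [piTrace, Finset.mul_sum]

lemma piTrace_mul_comm (A B : ∀ i, Matrix (Fin (d i)) (Fin (d i)) ℂ) :
    piTrace (A * B) = piTrace (B * A) := by
  simp only [piTrace, Pi.mul_apply]
  exact Finset.sum_congr rfl fun i _ => trace_mul_comm _ _

open Classical in
lemma piTrace_single (i : ι) (M : Matrix (Fin (d i)) (Fin (d i)) ℂ) :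
    piTrace (Pi.single i M) = M.trace := by
  rw [piTrace, Finset.sum_eq_single i] <;> simp +contextual [Pi.single_eq_of_ne]

open Classical in
/-- The trace pairing is nondegenerate. -/
lemma eq_of_piTrace_mul {x y : ∀ i, Matrix (Fin (d i)) (Fin (d i)) ℂ}
    (h : ∀ A, piTrace (x * A) = piTrace (y * A)) : x = y := by
  funext i
  refine ext_iff_trace_mul_right.2 fun M => ?_
  have := h (Pi.single i M)
  rwa [← Pi.single_mul_right, ← Pi.single_mul_right, piTrace_single, piTrace_single] at this

open Classical in
lemma IsMinProjPi.piTrace_eq_one {q : ∀ i, Matrix (Fin (d i)) (Fin (d i)) ℂ}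
    (hq : IsMinProjPi q) : piTrace q = 1 := by
  obtain ⟨h0, hstar, hidem, hmin⟩ := hq
  obtain ⟨j, hj⟩ := Function.ne_iff.1 h0
  have hcol : ∃ c, (q j).col c ≠ 0 := by
    by_contra! h
    exact hj (Matrix.ext fun a c => congrFun (h c) a)
  obtain ⟨c, hc⟩ := hcol
  set v := (q j).col c with hv
  have hqv : q j *ᵥ v = v := by
    ext a
    exact congrFun (congrFun (congrFun hidem j) a) c
  set t := star v ⬝ᵥ v with ht
  have ht0 : t ≠ 0 := fun h => hc (dotProduct_star_self_eq_zero.1 h)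
  have htstar : star t = t := (star_dotProduct v v).symm
  set r : Matrix (Fin (d j)) (Fin (d j)) ℂ := t⁻¹ • vecMulVec v (star v) with hr
  have hrstar : star r = r := by
    rw [hr, star_eq_conjTranspose, conjTranspose_smul, conjTranspose_vecMulVec, star_star,
      star_inv₀, htstar]
  have hrr : r * r = r := by
    rw [hr, smul_mul_smul_comm, vecMulVec_mul_vecMulVec, ← ht, vecMulVec_smul, smul_smul,
      inv_mul_cancel_right₀ ht0]
  have hqr : q j * r = r := by rw [hr, mul_smul_comm, mul_vecMulVec, hqv]
  have hrq : r * q j = r := by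
    have := congrArg star hqr
    rwa [star_mul, hrstar, show star (q j) = q j from congrFun hstar j] at this
  have htr : r.trace = 1 := by
    rw [hr, trace_smul, trace_vecMulVec, dotProduct_comm, ← ht, smul_eq_mul, inv_mul_cancel₀ ht0]
  rcases hmin (Pi.single j r) (by rw [← Pi.single_star, hrstar]) (by rw [← Pi.single_mul, hrr])
    (by rw [← Pi.single_mul_left, hrq]) with h | h
  · rw [Pi.single_eq_zero_iff] at h
    simp [h] at htr
  · rw [← h, piTrace_single, htr]

open Classical in
lemma isMinProjPi_single (i : ι) (c : Fin (d i)) :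
    IsMinProjPi (Pi.single i (Matrix.single c c 1) :
      ∀ i, Matrix (Fin (d i)) (Fin (d i)) ℂ) := by
  have hE : star (Matrix.single c c (1 : ℂ)) = Matrix.single c c 1 := by
    rw [star_eq_conjTranspose, conjTranspose_single, star_one]
  refine ⟨?_, by rw [← Pi.single_star, hE], by simp [← Pi.single_mul], fun q hs hi hq => ?_⟩
  · rw [Ne, Pi.single_eq_zero_iff]
    intro h
    simpa using congrFun (congrFun h c) c
  have hq' : Pi.single i (Matrix.single c c 1) * q = q := by
    have := congrArg star hq
    rwa [star_mul, hs, ← Pi.single_star, hE] at this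
  have hqi : Matrix.single c c 1 * q i = Matrix.single c c (q i c c) := by
    have h1 := congrFun hq i
    rw [Pi.mul_apply, Pi.single_eq_same] at h1
    rw [← h1, ← mul_assoc, single_mul_mul_single]
    simp
  have key : q = q i c c • Pi.single i (Matrix.single c c 1) := by
    rw [← Pi.single_smul, smul_single, smul_eq_mul, mul_one]
    rw [← hqi, Pi.single_mul_left, hq']
  have hx : q i c c * q i c c = q i c c := by
    have h1 := congrFun (congrFun (congrFun hi i) c) c
    have h2 : q i = Matrix.single c c (q i c c) := by
      have := congrFun key i
      simpa [smul_single] using this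
    rw [Pi.mul_apply, h2] at h1
    simpa using h1
  rcases IsIdempotentElem.iff_eq_zero_or_one.1 hx with h | h
  · left; rw [key, h, zero_smul]
  · right; rw [key, h, one_smul]

open Classical in
/-- The support of a homomorphism: a central projection `z` whose complement generates the
kernel. -/
lemma exists_support
    (μ : (∀ i, Matrix (Fin (d i)) (Fin (d i)) ℂ) →⋆ₐ[ℂ]
         (∀ j, Matrix (Fin (e j)) (Fin (e j)) ℂ)) :
    ∃ z : ∀ i, Matrix (Fin (d i)) (Fin (d i)) ℂ,
      star z = z ∧ z * z = z ∧ (∀ a, z * a = a * z) ∧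
      (∀ a, μ a = 0 ↔ z * a = 0) ∧ ∀ i, z i = 0 ∨ z i = 1 := by
  refine ⟨fun i => if μ (Pi.single i 1) = 0 then 0 else 1, ?_, ?_, fun a => ?_, fun a => ?_,
    fun i => ?_⟩
  · funext i; simp only [Pi.star_apply]; split_ifs <;> simp
  · funext i; simp only [Pi.mul_apply]; split_ifs <;> simp
  · funext i; simp only [Pi.mul_apply]; split_ifs <;> simp
  · refine ⟨fun h => ?_, fun h => ?_⟩
    · funext i
      simp only [Pi.mul_apply, Pi.zero_apply]
      split_ifs with hi
      · simp
      · by_contra hne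
        rw [one_mul] at hne
        refine hi (map_single_one_eq_zero μ hne ?_)
        rw [← one_mul (a i), Pi.single_mul_left, map_mul, h, mul_zero]
    · rw [← Finset.univ_sum_single a, map_sum]
      refine Finset.sum_eq_zero fun i _ => ?_
      have hi := congrFun h i
      simp only [Pi.mul_apply, Pi.zero_apply] at hi
      split_ifs at hi with h0
      · rw [← one_mul (a i), Pi.single_mul_left, map_mul, h0, zero_mul]
      · rw [one_mul] at hi
        simp [hi]
  · dsimp only; split_ifs <;> simp

lemma IsMinProjPi.map [Fintype κ]
    {μ : (∀ i, Matrix (Fin (d i)) (Fin (d i)) ℂ) →⋆ₐ[ℂ]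
         (∀ j, Matrix (Fin (e j)) (Fin (e j)) ℂ)}
    (hsurj : Function.Surjective μ) {p : ∀ i, Matrix (Fin (d i)) (Fin (d i)) ℂ}
    (hp : IsMinProjPi p) (h0 : μ p ≠ 0) : IsMinProjPi (μ p) := by
  obtain ⟨z, hzs, hzz, hzc, hker, -⟩ := exists_support μ
  have heq : ∀ {a b}, μ a = μ b → z * a = z * b := fun {a b} h => by
    rw [← sub_eq_zero, ← mul_sub, ← hker, map_sub, h, sub_self]
  have hmz : ∀ a, μ (z * a) = μ a := fun a => by
    rw [← sub_eq_zero, ← map_sub, hker, mul_sub, ← mul_assoc, hzz, sub_self]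
  refine ⟨h0, by rw [← map_star, hp.2.1], by rw [← map_mul, hp.2.2.1], fun q hs hi hq => ?_⟩
  obtain ⟨b, rfl⟩ := hsurj q
  rw [← map_star] at hs
  rw [← map_mul] at hi hq
  have := hp.2.2.2 (z * b) (by rw [star_mul, hzs, ← hzc, heq hs])
    (by rw [mul_assoc, ← mul_assoc b, ← hzc b, mul_assoc, ← mul_assoc, hzz, heq hi])
    (by rw [mul_assoc, heq hq])
  rw [← hmz b]
  exact this.imp (fun h => by rw [h, map_zero]) (fun h => by rw [h])

open Classical in
/-- A surjective homomorphism carries the canonical trace to its restriction to the support. -/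
lemma piTrace_map_eq [Fintype κ]
    {μ : (∀ i, Matrix (Fin (d i)) (Fin (d i)) ℂ) →⋆ₐ[ℂ]
         (∀ j, Matrix (Fin (e j)) (Fin (e j)) ℂ)}
    (hsurj : Function.Surjective μ) {z : ∀ i, Matrix (Fin (d i)) (Fin (d i)) ℂ}
    (hker : ∀ a, μ a = 0 ↔ z * a = 0) (hz : ∀ i, z i = 0 ∨ z i = 1)
    (a : ∀ i, Matrix (Fin (d i)) (Fin (d i)) ℂ) : piTrace (μ a) = piTrace (z * a) := by
  let f : (∀ i, Matrix (Fin (d i)) (Fin (d i)) ℂ) →ₗ[ℂ] ℂ :=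
    { toFun := fun a => piTrace (μ a)
      map_add' := fun a b => by rw [map_add, piTrace_add]
      map_smul' := fun c a => by rw [map_smul, piTrace_smul]; rfl }
  let g : (∀ i, Matrix (Fin (d i)) (Fin (d i)) ℂ) →ₗ[ℂ] ℂ :=
    { toFun := fun a => piTrace (z * a)
      map_add' := fun a b => by rw [mul_add, piTrace_add]
      map_smul' := fun c a => by rw [mul_smul_comm, piTrace_smul]; rfl }
  suffices f = g from LinearMap.congr_fun this a
  refine LinearMap.pi_ext' fun i => Matrix.ext_linearMap _ fun k l => LinearMap.ext_ring ?_
  change piTrace (μ (Pi.single i (Matrix.single k l 1))) =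
    piTrace (z * Pi.single i (Matrix.single k l 1))
  by_cases hkl : k = l
  · subst hkl
    have hmin := isMinProjPi_single i k
    by_cases h0 : μ (Pi.single i (Matrix.single k k 1)) = 0
    · rw [h0, (hker _).1 h0]
      simp [piTrace]
    · rw [(hmin.map hsurj h0).piTrace_eq_one, ← Pi.single_mul_right, piTrace_single]
      rcases hz i with h | h
      · refine absurd ((hker _).2 ?_) h0
        rw [← Pi.single_mul_right, h, zero_mul, Pi.single_zero]
      · simp [h]
  · have hE : Matrix.single k l (1 : ℂ) = Matrix.single k k 1 * Matrix.single k l 1 := by simp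
    have hE' : Matrix.single k l (1 : ℂ) * Matrix.single k k 1 = 0 :=
      single_mul_single_of_ne _ _ _ _ (Ne.symm hkl) _
    rw [← Pi.single_mul_right, piTrace_single, hE, Pi.single_mul, map_mul, piTrace_mul_comm,
      ← map_mul, ← Pi.single_mul, hE', Pi.single_zero, map_zero, ← hE]
    rcases hz i with h | h <;> simp [h, piTrace, trace_single_eq_of_ne _ _ _ hkl]

end PiTrace

/-- properties of the trace-adjoint `μ_*` of a surjective unital
*-algebra homomorphism `μ` between finite direct sums of matrix algebras:
(i) `μ_*(μ(p)) = p` for minimal projections `p` with `μ(p) ≠ 0`;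
(ii) `μ(μ_*(q)) = q` for minimal projections `q`; (iii) `μ_*` translates spectral
decompositions of states back through `μ`, hence preserves nonzero eigenvalues of
density operators. -/
theorem adjoint_of_surjective_star_hom {ι κ : Type} [Fintype ι] [Fintype κ]
    (d : ι → ℕ) (e : κ → ℕ)
    (μ : (∀ i, Matrix (Fin (d i)) (Fin (d i)) ℂ) →⋆ₐ[ℂ]
         (∀ j, Matrix (Fin (e j)) (Fin (e j)) ℂ))
    (hsurj : Function.Surjective μ)
    (ν : (∀ j, Matrix (Fin (e j)) (Fin (e j)) ℂ) →ₗ[ℂ]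
         (∀ i, Matrix (Fin (d i)) (Fin (d i)) ℂ))
    (hν : ∀ A B, piTrace (ν B * A) = piTrace (B * μ A)) :
    (∀ p, IsMinProjPi p → μ p = 0 ∨ ν (μ p) = p) ∧
    (∀ q, IsMinProjPi q → μ (ν q) = q) ∧
    (∀ (ρ : ∀ j, Matrix (Fin (e j)) (Fin (e j)) ℂ),
      (∀ j, (ρ j).PosSemidef) → piTrace ρ = 1 →
      ∀ {κ' : Type} [Fintype κ'] (α : κ' → ℝ)
        (p : κ' → ∀ i, Matrix (Fin (d i)) (Fin (d i)) ℂ),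
        (∀ k, 0 < α k) → (∀ k, IsMinProjPi (p k)) →
        (∀ k l, k ≠ l → p k * p l = 0) →
        ν ρ = ∑ k, (α k : ℂ) • p k →
        (ρ = ∑ k, (α k : ℂ) • μ (p k) ∧
         (∀ k, IsMinProjPi (μ (p k))) ∧
         (∀ k l, k ≠ l → μ (p k) * μ (p l) = 0))) := by
  obtain ⟨z, hzs, hzz, hzc, hker, hz⟩ := exists_support μ
  have hmz : ∀ a, μ (z * a) = μ a := fun a => by
    rw [← sub_eq_zero, ← map_sub, hker, mul_sub, ← mul_assoc, hzz, sub_self]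
  have hνμ : ∀ b, ν (μ b) = z * b := fun b => eq_of_piTrace_mul fun A => by
    rw [hν, ← map_mul, piTrace_map_eq hsurj hker hz, mul_assoc]
  have hμν : ∀ q, μ (ν q) = q := fun q => by
    obtain ⟨b, rfl⟩ := hsurj q
    rw [hνμ, hmz]
  refine ⟨fun p hp => ?_, fun q _ => hμν q, ?_⟩
  · by_cases h0 : μ p = 0
    · exact Or.inl h0
    · right
      rw [hνμ]
      refine (hp.2.2.2 (z * p) (by rw [star_mul, hzs, hp.2.1, hzc])
        (by rw [mul_assoc, ← mul_assoc p, ← hzc p, mul_assoc, ← mul_assoc, hzz, hp.2.2.1])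
        (by rw [mul_assoc, hp.2.2.1])).resolve_left fun h => h0 ((hker p).2 h)
  · intro ρ _ _ κ' _ α p hα hp hpp hρ
    refine ⟨?_, fun k => (hp k).map hsurj fun h => ?_,
      fun k l hkl => by rw [← map_mul, hpp k l hkl, map_zero]⟩
    · rw [← hμν ρ, hρ, map_sum]
      exact Finset.sum_congr rfl fun k _ => map_smul μ _ _
    have h1 : ν ρ * p k = (α k : ℂ) • p k := by
      rw [hρ, Finset.sum_mul, Finset.sum_eq_single k, smul_mul_assoc, (hp k).2.2.1]
      · intro l _ hl
        rw [smul_mul_assoc, hpp l k hl, smul_zero]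
      · simp
    have h2 : ν ρ * p k = 0 := by
      obtain ⟨b, rfl⟩ := hsurj ρ
      rw [hνμ, hzc, mul_assoc, (hker _).1 h, mul_zero]
    rw [h1, smul_eq_zero] at h2
    exact h2.elim (by exact_mod_cast (hα k).ne') (hp k).1
end
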